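/- arXiv:1512.04303 — 3 statements merged into one kernel-verified Lean document; each statement's English description precedes it below -/
import Mathlib

section
/- Let C₁ and C₂ be finite nonempty sets of trajectories such that for every t ∈ [0,1] the closed intervals [min_{s∈C₁} x_s(t), max_{s∈C₁} x_s(t)] and [min_{s∈C₂} x_s(t), max_{s∈C₂} x_s(t)] have a common point. Then diam(C₁ ∪ C₂) ≤ diam(C₁) + diam(C₂). -/
noncomputable section

/-- Position at time `t` of the trajectory `(a, v)`, i.e. `a + v*t`. -/
def trajPos (s : ℝ × ℝ) (t : ℝ) : ℝ := s.1 + s.2 * t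

/-- Diameter of a finite set of trajectories: the integral over `[0,1]` of the
width of the set of positions; `0` for the empty set. -/
noncomputable def kdiam (C : Finset (ℝ × ℝ)) : ℝ :=
  if h : C.Nonempty then
    ∫ t in (0:ℝ)..1,
      (C.sup' h (fun s => trajPos s t) - C.inf' h (fun s => trajPos s t))
  else 0

/-- A `k`-clustering of `S`: pairwise disjoint (possibly empty) clusters
indexed by `Fin k` whose union is `S`. -/
def IsClustering (S : Finset (ℝ × ℝ)) (k : ℕ) (𝒞 : Fin k → Finset (ℝ × ℝ)) : Prop :=
  (∀ i j : Fin k, i ≠ j → Disjoint (𝒞 i) (𝒞 j)) ∧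
  Finset.univ.biUnion 𝒞 = S

/-- Sum of the diameters of the clusters. -/
noncomputable def sd {k : ℕ} (𝒞 : Fin k → Finset (ℝ × ℝ)) : ℝ :=
  ∑ i, kdiam (𝒞 i)

/-- Maximum diameter of a cluster. -/
noncomputable def md {k : ℕ} (𝒞 : Fin k → Finset (ℝ × ℝ)) : ℝ :=
  ⨆ i, kdiam (𝒞 i)

/-- An SD-optimal `k`-clustering: minimizes `sd` among all `k`-clusterings of `S`. -/
def SDOptimal (S : Finset (ℝ × ℝ)) (k : ℕ) (𝒞 : Fin k → Finset (ℝ × ℝ)) : Prop :=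
  IsClustering S k 𝒞 ∧
  ∀ 𝒟 : Fin k → Finset (ℝ × ℝ), IsClustering S k 𝒟 → sd 𝒞 ≤ sd 𝒟

/-- Optimal value of the maximum diameter over all `k`-clusterings of `S`. -/
noncomputable def optmd (S : Finset (ℝ × ℝ)) (k : ℕ) : ℝ :=
  sInf {x | ∃ 𝒞 : Fin k → Finset (ℝ × ℝ), IsClustering S k 𝒞 ∧ x = md 𝒞}

/-- The strip `{(x,t) : 0 ≤ t ≤ 1}`. -/
def strip : Set (ℝ × ℝ) := {p | 0 ≤ p.2 ∧ p.2 ≤ 1}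

/-- The graph of a trajectory inside the strip. -/
def trajGraph (s : ℝ × ℝ) : Set (ℝ × ℝ) :=
  {p | 0 ≤ p.2 ∧ p.2 ≤ 1 ∧ p.1 = trajPos s p.2}

/-- The strip minus the union of the graphs of the trajectories of `S`. -/
def freeRegion (S : Finset (ℝ × ℝ)) : Set (ℝ × ℝ) :=
  strip \ ⋃ s ∈ S, trajGraph s

/-- A hole of `S`: a connected component of the strip minus the graphs. -/
def IsHole (S : Finset (ℝ × ℝ)) (h : Set (ℝ × ℝ)) : Prop :=
  ∃ p ∈ freeRegion S, h = connectedComponentIn (freeRegion S) p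

/-- `s` is to the left of the hole `h`. -/
def LeftOf (s : ℝ × ℝ) (h : Set (ℝ × ℝ)) : Prop :=
  ∃ p ∈ h, trajPos s p.2 < p.1

open Classical in
/-- The trajectories of `S` to the left of `h`. -/
noncomputable def Sleft (S : Finset (ℝ × ℝ)) (h : Set (ℝ × ℝ)) : Finset (ℝ × ℝ) :=
  S.filter (fun s => LeftOf s h)

open Classical in
/-- The trajectories of `S` to the right of `h`. -/
noncomputable def Sright (S : Finset (ℝ × ℝ)) (h : Set (ℝ × ℝ)) : Finset (ℝ × ℝ) :=
  S.filter (fun s => ¬ LeftOf s h)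

/-- The hole `h` separates the clusters `A` and `B`. -/
def Separates (S : Finset (ℝ × ℝ)) (h : Set (ℝ × ℝ))
    (A B : Finset (ℝ × ℝ)) : Prop :=
  (A ⊆ Sleft S h ∧ B ⊆ Sright S h) ∨ (B ⊆ Sleft S h ∧ A ⊆ Sright S h)

/-- The span of a cluster: the region of the strip between its left and right sides. -/
noncomputable def cspan (C : Finset (ℝ × ℝ)) : Set (ℝ × ℝ) :=
  if h : C.Nonempty then
    {p | 0 ≤ p.2 ∧ p.2 ≤ 1 ∧
      C.inf' h (fun s => trajPos s p.2) ≤ p.1 ∧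
      p.1 ≤ C.sup' h (fun s => trajPos s p.2)}
  else ∅

/-- A hole is covered by a clustering if it is contained in the span of some cluster. -/
def Covered {k : ℕ} (𝒞 : Fin k → Finset (ℝ × ℝ)) (h : Set (ℝ × ℝ)) : Prop :=
  ∃ i, h ⊆ cspan (𝒞 i)

/-- A well-separated clustering: every two distinct nonempty clusters are
separated by some uncovered hole. -/
def WellSeparated (S : Finset (ℝ × ℝ)) (k : ℕ)
    (𝒞 : Fin k → Finset (ℝ × ℝ)) : Prop :=
  IsClustering S k 𝒞 ∧
  ∀ i j : Fin k, i ≠ j → (𝒞 i).Nonempty → (𝒞 j).Nonempty →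
    ∃ h, IsHole S h ∧ ¬ Covered 𝒞 h ∧ Separates S h (𝒞 i) (𝒞 j)

end

/-- The width of a finite set of trajectories is a continuous function of time. -/
theorem continuous_width (C : Finset (ℝ × ℝ)) (h : C.Nonempty) :
    Continuous fun t => C.sup' h (fun s => trajPos s t) - C.inf' h (fun s => trajPos s t) := by
  have hpos : ∀ s ∈ C, Continuous (trajPos s) := fun s _ => by
    unfold trajPos
    fun_prop
  exact (Continuous.finset_sup'_apply h hpos).sub (Continuous.finset_inf'_apply h hpos)

/-- if the position intervals of two nonempty clusters meet at every
time `t ∈ [0,1]` then the diameter is subadditive on their union. -/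
theorem stmt2 (C₁ C₂ : Finset (ℝ × ℝ)) (h₁ : C₁.Nonempty) (h₂ : C₂.Nonempty)
    (hmeet : ∀ t ∈ Set.Icc (0:ℝ) 1, ∃ x : ℝ,
      C₁.inf' h₁ (fun s => trajPos s t) ≤ x ∧ x ≤ C₁.sup' h₁ (fun s => trajPos s t) ∧
      C₂.inf' h₂ (fun s => trajPos s t) ≤ x ∧ x ≤ C₂.sup' h₂ (fun s => trajPos s t)) :
    kdiam (C₁ ∪ C₂) ≤ kdiam C₁ + kdiam C₂ := by
  have hwidth : ∀ (C : Finset (ℝ × ℝ)) (h : C.Nonempty),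
      IntervalIntegrable (fun t => C.sup' h (fun s => trajPos s t) -
        C.inf' h (fun s => trajPos s t)) MeasureTheory.volume 0 1 :=
    fun C h => (continuous_width C h).intervalIntegrable 0 1
  rw [kdiam, kdiam, kdiam, dif_pos h₁, dif_pos h₂, dif_pos (h₁.mono Finset.subset_union_left),
    ← intervalIntegral.integral_add (hwidth C₁ h₁) (hwidth C₂ h₂)]
  refine intervalIntegral.integral_mono_on zero_le_one (hwidth _ _)
    ((hwidth C₁ h₁).add (hwidth C₂ h₂)) fun t ht => ?_
  obtain ⟨x, hm₁, hM₁, hm₂, hM₂⟩ := hmeet t ht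
  rw [Finset.sup'_union h₁ h₂, Finset.inf'_union h₁ h₂]
  grind
end

section
/- Let S be a finite set of at least two pairwise distinct trajectories, let k ≥ 2, and let 𝒞* bem an SD-optimal k-clustering of S. Then there is at least one bounded hole of S that is uncovered by 𝒞*, i.e., a hole that is a bounded subset of ℝ² and is not contained in cspan(C) for any cluster C of 𝒞*. -/
/-- The width at time `t` of the set of positions of `C`. -/
noncomputable def posWidth (C : Finset (ℝ × ℝ)) (t : ℝ) : ℝ :=
  if h : C.Nonempty then
    C.sup' h (fun s => trajPos s t) - C.inf' h (fun s => trajPos s t)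
  else 0

theorem continuous_trajPos (s : ℝ × ℝ) : Continuous (trajPos s) := by
  unfold trajPos
  fun_prop

theorem continuous_posWidth (C : Finset (ℝ × ℝ)) : Continuous (posWidth C) := by
  unfold posWidth
  split_ifs with h
  · exact (Continuous.finset_sup'_apply h fun s _ => continuous_trajPos s).sub
      (Continuous.finset_inf'_apply h fun s _ => continuous_trajPos s)
  · exact continuous_const

theorem kdiam_eq_integral_posWidth (C : Finset (ℝ × ℝ)) :
    kdiam C = ∫ t in (0:ℝ)..1, posWidth C t := by
  unfold kdiam posWidth
  split_ifs with h <;> simp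

theorem posWidth_nonneg (C : Finset (ℝ × ℝ)) (t : ℝ) : 0 ≤ posWidth C t := by
  unfold posWidth
  split_ifs with h
  · obtain ⟨s, hs⟩ := h
    exact sub_nonneg.2 ((Finset.inf'_le (fun s => trajPos s t) hs).trans
      (Finset.le_sup' (fun s => trajPos s t) hs))
  · exact le_rfl

theorem posWidth_mono {C D : Finset (ℝ × ℝ)} (h : C ⊆ D) (t : ℝ) :
    posWidth C t ≤ posWidth D t := by
  by_cases hC : C.Nonempty
  · have hD := hC.mono h
    simp only [posWidth, hC, hD, dif_pos]
    exact sub_le_sub (Finset.sup'_mono _ h hC) (Finset.inf'_mono _ h hC)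
  · rw [posWidth, dif_neg hC]
    exact posWidth_nonneg D t

theorem exists_injOn_trajPos (S : Finset (ℝ × ℝ)) :
    ∃ t ∈ Set.Ioo (0:ℝ) 1, Set.InjOn (fun s => trajPos s t) S := by
  have hfin : (⋃ p ∈ S.offDiag, {t : ℝ | trajPos p.1 t = trajPos p.2 t}).Finite := by
    refine S.offDiag.finite_toSet.biUnion fun p hp => Set.Subsingleton.finite ?_
    intro t ht u hu
    have hne := (Finset.mem_offDiag.1 hp).2.2
    simp only [trajPos, Set.mem_ofPred_eq] at ht hu
    by_contra htu
    have hv : p.1.2 = p.2.2 := by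
      have : (p.1.2 - p.2.2) * (t - u) = 0 := by linarith
      rcases mul_eq_zero.1 this with h | h
      · linarith
      · exact absurd (sub_eq_zero.1 h) htu
    refine hne (Prod.ext ?_ hv)
    rw [hv] at ht
    linarith
  obtain ⟨t, ht, hbad⟩ := ((Set.Ioo_infinite (zero_lt_one (α := ℝ))).sdiff hfin).nonempty
  refine ⟨t, ht, fun s hs u hu hsu => ?_⟩
  by_contra hne
  exact hbad (Set.mem_biUnion (x := (s, u)) (Finset.mem_offDiag.2 ⟨hs, hu, hne⟩) hsu)

/-- Some trajectory can be removed from `S` so that the diameter strictly decreases. -/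
theorem exists_kdiam_erase_lt (S : Finset (ℝ × ℝ)) (hS : 2 ≤ S.card) :
    ∃ s ∈ S, kdiam (S.erase s) < kdiam S := by
  obtain ⟨t, ht, hinj⟩ := exists_injOn_trajPos S
  have hne : S.Nonempty := Finset.card_pos.1 (by omega)
  obtain ⟨s, hs, hmax⟩ := S.exists_max_image (fun s => trajPos s t) hne
  refine ⟨s, hs, ?_⟩
  have hE : (S.erase s).Nonempty := by
    rw [← Finset.card_pos, Finset.card_erase_of_mem hs]
    omega
  simp only [kdiam_eq_integral_posWidth]
  refine intervalIntegral.integral_lt_integral_of_continuousOn_of_le_of_exists_lt zero_lt_one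
    (continuous_posWidth _).continuousOn (continuous_posWidth _).continuousOn
    (fun u _ => posWidth_mono (S.erase_subset s) u) ⟨t, Set.Ioo_subset_Icc_self ht, ?_⟩
  simp only [posWidth, hE, hne, dif_pos]
  rw [sub_eq_add_neg, sub_eq_add_neg]
  refine add_lt_add_of_lt_of_le ?_ (neg_le_neg <| Finset.inf'_mono _ (S.erase_subset s) hE)
  refine lt_of_lt_of_le ?_ (Finset.le_sup' (fun s => trajPos s t) hs)
  refine (Finset.sup'_lt_iff hE).2 fun u hu => ?_
  obtain ⟨hus, huS⟩ := Finset.mem_erase.1 hu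
  exact lt_of_le_of_ne (hmax u huS) fun h => hus (hinj huS hs h)

theorem kdiam_empty : kdiam ∅ = 0 := by simp [kdiam]

theorem kdiam_singleton (s : ℝ × ℝ) : kdiam {s} = 0 := by simp [kdiam]

/-- An SD-optimal clustering with at least two clusters beats the one-cluster solution. -/
theorem SDOptimal.sd_lt_kdiam {S : Finset (ℝ × ℝ)} (hS : 2 ≤ S.card) {k : ℕ} (hk : 2 ≤ k)
    {𝒞 : Fin k → Finset (ℝ × ℝ)} (hopt : SDOptimal S k 𝒞) : sd 𝒞 < kdiam S := by
  obtain ⟨s, hs, hlt⟩ := exists_kdiam_erase_lt S hS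
  let i₀ : Fin k := ⟨0, by omega⟩
  let i₁ : Fin k := ⟨1, by omega⟩
  have h01 : i₁ ≠ i₀ := by simp [i₀, i₁]
  let 𝒟 : Fin k → Finset (ℝ × ℝ) := fun i =>
    if i = i₀ then S.erase s else if i = i₁ then {s} else ∅
  have h𝒟 : IsClustering S k 𝒟 := by
    constructor
    · intro i j hij
      simp only [𝒟]
      split_ifs <;> simp_all
    · ext u
      simp only [Finset.mem_biUnion, Finset.mem_univ, true_and, 𝒟]
      constructor
      · rintro ⟨i, hi⟩
        split_ifs at hi
        · exact Finset.mem_of_mem_erase hi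
        · rwa [Finset.mem_singleton.1 hi]
        · simp at hi
      · intro hu
        by_cases hus : u = s
        · exact ⟨i₁, by simp [h01, hus]⟩
        · exact ⟨i₀, by simp [hus, hu]⟩
  have hsd : sd 𝒟 = kdiam (S.erase s) := by
    unfold sd
    rw [Finset.sum_eq_single i₀ _ (by simp)]
    · simp [𝒟]
    · intro i _ hi
      simp only [𝒟, hi, if_false]
      split_ifs
      · exact kdiam_singleton s
      · exact kdiam_empty
  exact (hopt.2 𝒟 h𝒟).trans_lt (hsd ▸ hlt)

/-- A preconnected subset of the free region lies on one side of each trajectory. -/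
theorem IsPreconnected.trajPos_lt {S : Finset (ℝ × ℝ)} {A : Set (ℝ × ℝ)}
    (hA : IsPreconnected A) (hAS : A ⊆ freeRegion S) {s : ℝ × ℝ} (hs : s ∈ S)
    {p q : ℝ × ℝ} (hp : p ∈ A) (hq : q ∈ A) (h : trajPos s p.2 < p.1) :
    trajPos s q.2 < q.1 := by
  by_contra! hle
  have hcont : Continuous fun z : ℝ × ℝ => z.1 - trajPos s z.2 :=
    continuous_fst.sub ((continuous_trajPos s).comp continuous_snd)
  obtain ⟨z, hz, hz0⟩ := hA.intermediate_value hq hp hcont.continuousOn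
    (show (0:ℝ) ∈ Set.Icc _ _ from ⟨by linarith, by linarith⟩)
  obtain ⟨⟨h0, h1⟩, hfree⟩ := hAS hz
  exact hfree (Set.mem_biUnion hs ⟨h0, h1, by simpa [sub_eq_zero] using hz0⟩)

/-- A hole containing a point between two trajectories is bounded. -/
theorem isBounded_connectedComponentIn_freeRegion {S : Finset (ℝ × ℝ)} {p s u : ℝ × ℝ}
    (hp : p ∈ freeRegion S) (hs : s ∈ S) (hu : u ∈ S)
    (hsp : trajPos s p.2 < p.1) (hpu : p.1 < trajPos u p.2) :
    Bornology.IsBounded (connectedComponentIn (freeRegion S) p) := by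
  obtain ⟨a, ha⟩ := isCompact_Icc.bddBelow_image
    (continuous_trajPos s).continuousOn (K := Set.Icc (0:ℝ) 1)
  obtain ⟨b, hb⟩ := isCompact_Icc.bddAbove_image
    (continuous_trajPos u).continuousOn (K := Set.Icc (0:ℝ) 1)
  refine (Metric.isBounded_Icc ((a, 0) : ℝ × ℝ) (b, 1)).subset fun q hq => ?_
  have hsub := connectedComponentIn_subset (freeRegion S) p
  have hpre : IsPreconnected (connectedComponentIn (freeRegion S) p) :=
    isPreconnected_connectedComponentIn
  have hpmem := mem_connectedComponentIn hp
  have ht : q.2 ∈ Set.Icc (0:ℝ) 1 := (hsub hq).1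
  have h1 := hpre.trajPos_lt hsub hs hpmem hq hsp
  have h2 : q.1 ≤ trajPos u q.2 := by
    by_contra! h
    exact absurd (hpre.trajPos_lt hsub hu hq hpmem h) hpu.not_gt
  have ha' := ha (Set.mem_image_of_mem _ ht)
  have hb' := hb (Set.mem_image_of_mem _ ht)
  exact ⟨⟨ha'.trans h1.le, ht.1⟩, ⟨h2.trans hb', ht.2⟩⟩

theorem volume_cspan_slice_le (C : Finset (ℝ × ℝ)) (t : ℝ) :
    MeasureTheory.volume {x : ℝ | (x, t) ∈ cspan C} ≤ ENNReal.ofReal (posWidth C t) := by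
  unfold cspan posWidth
  split_ifs with h
  · rw [← Real.volume_Icc]
    exact MeasureTheory.measure_mono fun x hx => hx.2.2
  · simp

/-- If all bounded holes are covered, the widths of the clusters add up to at least
the width of `S` at each time. -/
theorem posWidth_le_sum_of_covered {S : Finset (ℝ × ℝ)} {k : ℕ} {𝒞 : Fin k → Finset (ℝ × ℝ)}
    (hcov : ∀ h, IsHole S h → Bornology.IsBounded h → Covered 𝒞 h)
    {t : ℝ} (ht : t ∈ Set.Icc (0:ℝ) 1) : posWidth S t ≤ ∑ i, posWidth (𝒞 i) t := by
  by_cases hne : S.Nonempty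
  swap
  · rw [posWidth, dif_neg hne]
    exact Finset.sum_nonneg fun i _ => posWidth_nonneg _ _
  obtain ⟨u, hu, hmax⟩ := S.exists_mem_eq_sup' hne (fun s => trajPos s t)
  obtain ⟨s, hs, hmin⟩ := S.exists_mem_eq_inf' hne (fun s => trajPos s t)
  have hsub : Set.Ioo (trajPos s t) (trajPos u t) ⊆
      (⋃ i, {x : ℝ | (x, t) ∈ cspan (𝒞 i)}) ∪ (fun s => trajPos s t) '' (S : Set (ℝ × ℝ)) := by
    intro x hx
    by_cases hxS : x ∈ (fun s => trajPos s t) '' (S : Set (ℝ × ℝ))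
    · exact Or.inr hxS
    left
    have hfree : (x, t) ∈ freeRegion S := by
      refine ⟨ht, fun hmem => ?_⟩
      obtain ⟨w, hw, hxw⟩ := Set.mem_iUnion₂.1 hmem
      exact hxS ⟨w, hw, hxw.2.2.symm⟩
    obtain ⟨i, hi⟩ := hcov _ ⟨_, hfree, rfl⟩
      (isBounded_connectedComponentIn_freeRegion hfree hs hu hx.1 hx.2)
    exact Set.mem_iUnion.2 ⟨i, hi (mem_connectedComponentIn hfree)⟩
  have hzero : MeasureTheory.volume ((fun s => trajPos s t) '' (S : Set (ℝ × ℝ))) = 0 :=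
    (S.finite_toSet.image _).measure_zero _
  have hvol : ENNReal.ofReal (posWidth S t) ≤ ENNReal.ofReal (∑ i, posWidth (𝒞 i) t) :=
    calc ENNReal.ofReal (posWidth S t)
        = MeasureTheory.volume (Set.Ioo (trajPos s t) (trajPos u t)) := by
          rw [Real.volume_Ioo, posWidth, dif_pos hne, hmax, hmin]
      _ ≤ MeasureTheory.volume (⋃ i, {x : ℝ | (x, t) ∈ cspan (𝒞 i)}) + 0 := by
          rw [← hzero]
          exact (MeasureTheory.measure_mono hsub).trans (MeasureTheory.measure_union_le _ _)
      _ ≤ ∑ i, MeasureTheory.volume {x : ℝ | (x, t) ∈ cspan (𝒞 i)} := by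
          rw [add_zero]
          exact MeasureTheory.measure_iUnion_fintype_le _ _
      _ ≤ ∑ i, ENNReal.ofReal (posWidth (𝒞 i) t) :=
          Finset.sum_le_sum fun i _ => volume_cspan_slice_le _ _
      _ = ENNReal.ofReal (∑ i, posWidth (𝒞 i) t) :=
          (ENNReal.ofReal_sum_of_nonneg fun i _ => posWidth_nonneg _ _).symm
  exact (ENNReal.ofReal_le_ofReal_iff
    (Finset.sum_nonneg fun i _ => posWidth_nonneg _ _)).1 hvol

theorem kdiam_le_sd_of_covered {S : Finset (ℝ × ℝ)} {k : ℕ} {𝒞 : Fin k → Finset (ℝ × ℝ)}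
    (hcov : ∀ h, IsHole S h → Bornology.IsBounded h → Covered 𝒞 h) : kdiam S ≤ sd 𝒞 := by
  simp only [sd, kdiam_eq_integral_posWidth]
  rw [← intervalIntegral.integral_finsetSum
    fun i _ => (continuous_posWidth (𝒞 i)).intervalIntegrable 0 1]
  exact intervalIntegral.integral_mono_on zero_le_one
    ((continuous_posWidth S).intervalIntegrable 0 1)
    ((continuous_finsetSum _ fun i _ => continuous_posWidth (𝒞 i)).intervalIntegrable 0 1)
    fun t ht => posWidth_le_sum_of_covered hcov ht

/-- for `k ≥ 2` an SD-optimal `k`-clustering leaves at least one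
bounded hole of `S` uncovered. -/
theorem stmt3 (S : Finset (ℝ × ℝ)) (hS : 2 ≤ S.card) (k : ℕ) (hk : 2 ≤ k)
    (𝒞 : Fin k → Finset (ℝ × ℝ)) (hopt : SDOptimal S k 𝒞) :
    ∃ h, IsHole S h ∧ Bornology.IsBounded h ∧ ¬ Covered 𝒞 h := by
  by_contra! hcov
  exact (hopt.sd_lt_kdiam hS hk).not_ge (kdiam_le_sd_of_covered hcov)
end

section
/- Let S be a finite set of pairwise distinct trajectories. Then every hole of S is a convex subset of ℝ². -/
theorem mem_freeRegion_iff {S : Finset (ℝ × ℝ)} {p : ℝ × ℝ} :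
    p ∈ freeRegion S ↔ p ∈ strip ∧ ∀ s ∈ S, p.1 ≠ trajPos s p.2 := by
  simp only [freeRegion, strip, trajGraph, Set.mem_sdiff, Set.mem_ofPred_eq, Set.mem_iUnion]
  grind

theorem continuous_sub_trajPos (s : ℝ × ℝ) :
    Continuous fun p : ℝ × ℝ => p.1 - trajPos s p.2 := by
  unfold trajPos
  fun_prop

theorem convex_strip : Convex ℝ strip := by
  rintro ⟨x, t⟩ ⟨h0, h1⟩ ⟨y, u⟩ ⟨h2, h3⟩ a b ha hb hab
  exact convex_Icc (0 : ℝ) 1 ⟨h0, h1⟩ ⟨h2, h3⟩ ha hb hab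

theorem convex_right_of_traj (s : ℝ × ℝ) : Convex ℝ {p : ℝ × ℝ | 0 < p.1 - trajPos s p.2} := by
  rintro ⟨x, t⟩ hx ⟨y, u⟩ hy a b ha hb hab
  have h := convex_Ioi (0 : ℝ) hx hy ha hb hab
  simp only [trajPos, Set.mem_Ioi, Set.mem_ofPred_eq, smul_eq_mul, Prod.smul_mk,
    Prod.mk_add_mk] at h ⊢
  linear_combination h - s.1 * hab

theorem convex_left_of_traj (s : ℝ × ℝ) : Convex ℝ {p : ℝ × ℝ | p.1 - trajPos s p.2 < 0} := by
  rintro ⟨x, t⟩ hx ⟨y, u⟩ hy a b ha hb hab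
  have h := convex_Iio (0 : ℝ) hx hy ha hb hab
  simp only [trajPos, Set.mem_Iio, Set.mem_ofPred_eq, smul_eq_mul, Prod.smul_mk,
    Prod.mk_add_mk] at h ⊢
  linear_combination h + s.1 * hab

/-- A segment joining two points of a preconnected subset of the free region stays in the
free region. -/
theorem segment_subset_freeRegion {S : Finset (ℝ × ℝ)} {C : Set (ℝ × ℝ)}
    (hC : IsPreconnected C) (hCS : C ⊆ freeRegion S) {x y : ℝ × ℝ} (hx : x ∈ C) (hy : y ∈ C) :
    segment ℝ x y ⊆ freeRegion S := by
  intro z hz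
  refine mem_freeRegion_iff.2 ⟨convex_strip.segment_subset (hCS hx).1 (hCS hy).1 hz,
    fun s hs => ?_⟩
  have hne : ∀ p ∈ C, p.1 - trajPos s p.2 ≠ 0 := fun p hp =>
    sub_ne_zero.2 ((mem_freeRegion_iff.1 (hCS hp)).2 s hs)
  have hcont := (continuous_sub_trajPos s).continuousOn (s := C)
  rcases (hne x hx).lt_or_gt with hx' | hx' <;> rcases (hne y hy).lt_or_gt with hy' | hy'
  · exact sub_ne_zero.1 ((convex_left_of_traj s).segment_subset hx' hy' hz).ne
  · obtain ⟨p, hp, hp0⟩ := hC.intermediate_value hx hy hcont ⟨hx'.le, hy'.le⟩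
    exact absurd hp0 (hne p hp)
  · obtain ⟨p, hp, hp0⟩ := hC.intermediate_value hy hx hcont ⟨hy'.le, hx'.le⟩
    exact absurd hp0 (hne p hp)
  · exact sub_ne_zero.1 ((convex_right_of_traj s).segment_subset hx' hy' hz).ne'

/-- every hole of `S` is a convex subset of the plane. -/
theorem stmt17 (S : Finset (ℝ × ℝ)) (h : Set (ℝ × ℝ)) (hh : IsHole S h) :
    Convex ℝ h := by
  obtain ⟨p, -, rfl⟩ := hh
  refine convex_iff_segment_subset.2 fun x hx y hy => ?_
  rw [connectedComponentIn_eq hx]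
  exact (convex_segment x y).isPreconnected.subset_connectedComponentIn (left_mem_segment ℝ x y)
    (segment_subset_freeRegion isPreconnected_connectedComponentIn
      (connectedComponentIn_subset _ _) hx hy)
end
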